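/- Let V = ℝ^{r₁} × ℂ^{r₂}, O_k ⊂ V the image of the ring of integers of a number field k, and U ⊂ V a bounded measurable set whose boundary ∂U has Lebesgue measure zero. Define D_t(U,v) = |(tU+v) ∩ O_k| − |Δ_k|^{-1/2}Leb(U)‖t‖ and D_t(U) = ess sup_v |D_t(U,v)|. Then either D_t(U) < 1 for all t ∈ V^×, or there exist δ > 0 and nonempty open sets T ⊆ V^×, W ⊆ V such that D_t(U,v) > 1 + δ for all t ∈ T and v ∈ W. -/

import Mathlib

open NumberField NumberField.InfinitePlace NumberField.mixedEmbedding MeasureTheory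
open scoped Classical

variable (K : Type*) [Field K] [NumberField K]

/-- The lattice point discrepancy `D_t(U, v) = |(tU + v) ∩ 𝓞_K| − |Δ_K|^{-1/2}·Leb(U)·‖t‖`
of a set `U` in the mixed space of `K`, where `tU` is coordinate-wise scaling by `t`. -/
noncomputable def discrep (U : Set (mixedSpace K)) (t v : mixedSpace K) : ℝ :=
  (Nat.card {x : 𝓞 K // mixedEmbedding K (x : K) ∈ (fun u => t * u + v) '' U} : ℝ) -
    (Real.sqrt |(discr K : ℝ)|)⁻¹ * (volume U).toReal * mixedEmbedding.norm t

/-- The maximal discrepancy `D_t(U) = ess sup_v |D_t(U, v)|`, valued in `EReal`. -/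
noncomputable def maxDiscrep (U : Set (mixedSpace K)) (t : mixedSpace K) : EReal :=
  essSup (fun v : mixedSpace K => ((|discrep K U t v| : ℝ) : EReal)) volume

section

/-- A Jensen-type bound: an entire function with many zeros near `0` is small at `0`. -/
theorem norm_apply_zero_le_of_forall_zero {r : ℝ} (hr : 0 < r) (s : Finset ℂ) {g : ℂ → ℂ} {M : ℝ}
    (hg : Differentiable ℂ g) (hM : ∀ z, ‖z‖ = 3 * r → ‖g z‖ ≤ M)
    (hs : ∀ z ∈ s, ‖z‖ ≤ r ∧ g z = 0) : ‖g 0‖ ≤ M * (1 / 2) ^ s.card := by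
  induction s using Finset.induction_on generalizing g M with
  | empty =>
    have := Complex.norm_le_of_forall_mem_frontier_norm_le (f := g) (U := Metric.ball 0 (3 * r))
      (C := M) Metric.isBounded_ball hg.diffContOnCl (fun z hz => hM z ?_) (z := 0) ?_
    · simpa using this
    · rw [frontier_ball _ (by positivity)] at hz
      simpa using hz
    · exact subset_closure (by simpa using hr)
  | insert a s ha ih =>
    have hga : g a = 0 := (hs a (by simp)).2
    have har : ‖a‖ ≤ r := (hs a (by simp)).1
    have hd : Differentiable ℂ (dslope g a) := by
      rw [← differentiableOn_univ] at hg ⊢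
      exact (Complex.differentiableOn_dslope Filter.univ_mem).2 hg
    have key (z : ℂ) : (z - a) * dslope g a z = g z := by
      have := sub_smul_dslope g a z
      rwa [hga, sub_zero, smul_eq_mul] at this
    have h1 := ih (M := M / (2 * r)) hd (fun z hz => by
      have h3 : 2 * r ≤ ‖z - a‖ := by
        have := norm_sub_norm_le z a
        linarith
      have h4 := hM z hz
      rw [← key z, norm_mul] at h4
      rw [le_div_iff₀ (by positivity)]
      nlinarith [norm_nonneg (dslope g a z)]) (fun z hz => by
      refine ⟨(hs z (by simp [hz])).1, ?_⟩
      have h2 := key z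
      rw [(hs z (by simp [hz])).2] at h2
      have : z - a ≠ 0 := sub_ne_zero.2 (fun h => ha (h ▸ hz))
      simpa [this] using h2)
    have h2 := key 0
    rw [← h2, norm_mul, zero_sub, norm_neg, Finset.card_insert_of_notMem ha]
    calc ‖a‖ * ‖dslope g a 0‖ ≤ r * (M / (2 * r) * (1 / 2) ^ s.card) := by gcongr
      _ = M * (1 / 2) ^ (s.card + 1) := by field_simp; ring

open ProbabilityTheory in
/-- If the cosine transform of a bounded function vanishes at all positive solutions `s` of
`c s ^ n = k`, `k = 1, 2, …`, with `n ≥ 2`, then it has more zeros than an entire function of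
exponential type can have, so the measure is zero. -/
theorem measure_univ_eq_zero_of_integral_cos_eq_zero {Ω : Type*} [MeasurableSpace Ω]
    (μ : Measure Ω) [IsFiniteMeasure μ] {f : Ω → ℝ} (hf : Measurable f) {B : ℝ}
    (hB : ∀ᵐ x ∂μ, |f x| ≤ B) {c : ℝ} (hc : 0 < c) {n : ℕ} (hn : 2 ≤ n)
    (h : ∀ k : ℕ, 1 ≤ k → ∀ s : ℝ, 0 < s → c * s ^ n = k → ∫ x, Real.cos (s * f x) ∂μ = 0) :
    μ Set.univ = 0 := by
  by_contra hμ
  have hμ0 : 0 < μ.real Set.univ := by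
    rw [measureReal_def]
    exact ENNReal.toReal_pos hμ (by simp)
  have : NeZero μ := ⟨fun h => hμ (by simp [h])⟩
  have hB0 : 0 ≤ B := by
    obtain ⟨x, hx⟩ := hB.exists
    exact (abs_nonneg _).trans hx
  have hbd (z : ℂ) : ∀ᵐ x ∂μ, ‖Complex.exp (z * f x)‖ ≤ Real.exp (B * ‖z‖) := by
    filter_upwards [hB] with x hx
    rw [Complex.norm_exp]
    gcongr
    calc (z * f x).re ≤ ‖z * f x‖ := Complex.re_le_norm _
      _ = |f x| * ‖z‖ := by rw [norm_mul, Complex.norm_real, Real.norm_eq_abs, mul_comm]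
      _ ≤ B * ‖z‖ := by gcongr
  have hint (z : ℂ) : Integrable (fun x => Complex.exp (z * f x)) μ :=
    Integrable.of_bound (by fun_prop) _ (hbd z)
  have hexp : integrableExpSet f μ = Set.univ := by
    refine Set.eq_univ_of_forall fun t => ?_
    have := (hint t).re
    refine this.congr (ae_of_all _ fun x => ?_)
    simp [← Complex.ofReal_mul, ← Complex.ofReal_exp]
  have hdiff : Differentiable ℂ (complexMGF f μ) := fun z =>
    (hasDerivAt_complexMGF (by simp [hexp])).differentiableAt
  have hle (z : ℂ) : ‖complexMGF f μ z‖ ≤ μ.real Set.univ * Real.exp (B * ‖z‖) := by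
    rw [mul_comm]
    exact norm_integral_le_of_norm_le_const (hbd z)
  set g : ℂ → ℂ := fun z => complexMGF f μ (z * Complex.I) + complexMGF f μ (-z * Complex.I)
    with hgdef
  have hg : Differentiable ℂ g := by fun_prop
  have hg0 : ‖g 0‖ = 2 * μ.real Set.univ := by
    have : g 0 = ((2 * μ.real Set.univ : ℝ) : ℂ) := by
      simp [hgdef, complexMGF]; ring
    rw [this, Complex.norm_real, Real.norm_of_nonneg (by positivity)]
  have hgs (s : ℝ) : g s = ((2 * ∫ x, Real.cos (s * f x) ∂μ : ℝ) : ℂ) := by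
    simp only [hgdef, complexMGF]
    rw [← integral_add (hint _) (hint _), ← integral_const_mul, ← integral_complex_ofReal]
    congr 1 with x
    push_cast
    rw [Complex.two_cos]
    ring_nf
  have hgM (z : ℂ) : ‖g z‖ ≤ 2 * μ.real Set.univ * Real.exp (B * ‖z‖) := by
    refine (norm_add_le _ _).trans ?_
    have h1 := hle (z * Complex.I)
    have h2 := hle (-z * Complex.I)
    simp only [norm_mul, norm_neg, Complex.norm_I, mul_one] at h1 h2
    linarith
  have key (R : ℝ) (hR : 1 ≤ R) : (c * R ^ 2 - 1) * Real.log 2 ≤ 3 * B * R := by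
    set m := ⌊c * R ^ n⌋₊ with hm
    have hn0 : n ≠ 0 := by omega
    set e : ℕ → ℂ := fun k => (((k / c) ^ ((n : ℝ)⁻¹) : ℝ) : ℂ) with he
    have hpow (k : ℕ) : (((k : ℝ) / c) ^ ((n : ℝ)⁻¹)) ^ n = k / c :=
      Real.rpow_inv_natCast_pow (by positivity) hn0
    have hinj : Function.Injective e := by
      intro k l hkl
      have h1 : ((k : ℝ) / c) ^ ((n : ℝ)⁻¹) = ((l : ℝ) / c) ^ ((n : ℝ)⁻¹) := by
        simpa only [he, Complex.ofReal_inj] using hkl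
      have h2 := hpow k
      rw [h1, hpow l] at h2
      field_simp at h2
      exact_mod_cast h2.symm
    have h1 := norm_apply_zero_le_of_forall_zero (r := R) (by linarith)
      ((Finset.Icc 1 m).image e) (g := g) (M := 2 * μ.real Set.univ * Real.exp (B * (3 * R))) hg
      (fun z hz => by rw [← hz]; exact hgM z) (fun z hz => by
        obtain ⟨k, hk, rfl⟩ := Finset.mem_image.1 hz
        rw [Finset.mem_Icc] at hk
        have hk0 : (0 : ℝ) < k := by exact_mod_cast hk.1
        constructor
        · rw [Complex.norm_real, Real.norm_of_nonneg (by positivity)]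
          refine le_of_pow_le_pow_left₀ hn0 (by linarith) ?_
          rw [hpow, div_le_iff₀ hc, mul_comm]
          exact (Nat.le_floor_iff (by positivity)).1 hk.2
        · rw [he, hgs, h k hk.1 _ (by positivity) (by rw [hpow]; field_simp)]
          simp)
    rw [Finset.card_image_of_injective _ hinj, Nat.card_Icc, Nat.add_sub_cancel, hg0] at h1
    have h2 : (2 : ℝ) ^ m ≤ Real.exp (B * (3 * R)) := by
      rw [mul_assoc, le_mul_iff_one_le_right (by positivity), one_div, inv_pow] at h1
      rwa [← div_eq_mul_inv, one_le_div (by positivity)] at h1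
    have h3 := Real.log_le_log (by positivity) h2
    rw [Real.log_exp, Real.log_pow] at h3
    have h4 : c * R ^ n - 1 ≤ m := by
      have := Nat.lt_floor_add_one (c * R ^ n)
      rw [← hm] at this
      linarith
    have h5 : R ^ 2 ≤ R ^ n := pow_le_pow_right₀ hR hn
    have h6 := Real.log_nonneg (x := 2) (by norm_num)
    calc (c * R ^ 2 - 1) * Real.log 2 ≤ m * Real.log 2 := by
          gcongr
          have := mul_le_mul_of_nonneg_left h5 hc.le
          linarith
      _ ≤ _ := by linarith
  have hl : 0 < Real.log 2 := Real.log_pos (by norm_num)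
  have hl1 : Real.log 2 ≤ 1 := by linarith [Real.log_two_lt_d9]
  set Λ := c * Real.log 2 with hΛ
  have hΛ0 : 0 < Λ := by positivity
  set R := 1 + (3 * B + 1) / Λ with hR
  have hR1 : 1 ≤ R := by
    have : 0 ≤ (3 * B + 1) / Λ := by positivity
    linarith
  have h1 := key R hR1
  have h2 : Λ * R = Λ + (3 * B + 1) := by rw [hR]; field_simp
  have h3 : Λ * R ^ 2 = (Λ + (3 * B + 1)) * R := by rw [← h2]; ring
  have h4 : (c * R ^ 2 - 1) * Real.log 2 = Λ * R ^ 2 - Real.log 2 := by rw [hΛ]; ring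
  nlinarith

/-- The second alternative of the dichotomy: the discrepancy exceeds `1` uniformly on some
nonempty open set of parameters. -/
def HasLargeDiscrepancy (U : Set (mixedSpace K)) : Prop :=
  ∃ δ : ℝ, 0 < δ ∧ ∃ T W : Set (mixedSpace K), IsOpen T ∧ T.Nonempty ∧ IsOpen W ∧
      W.Nonempty ∧ (∀ t ∈ T, mixedEmbedding.norm t ≠ 0) ∧
      ∀ t ∈ T, ∀ v ∈ W, 1 + δ < discrep K U t v

/-- The density factor `|Δ_K|^{-1/2}·Leb(U)`. -/
noncomputable def density (U : Set (mixedSpace K)) : ℝ :=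
  (Real.sqrt |(discr K : ℝ)|)⁻¹ * (volume U).toReal

theorem sqrt_abs_discr_pos : 0 < Real.sqrt |(discr K : ℝ)| :=
  Real.sqrt_pos.2 (abs_pos.2 (by exact_mod_cast discr_ne_zero K))

variable {K}

theorem density_nonneg (U : Set (mixedSpace K)) : 0 ≤ density K U := by
  unfold density; positivity

theorem finite_setOf_mixedEmbedding_mem {A : Set (mixedSpace K)} (hA : Bornology.IsBounded A) :
    {x : 𝓞 K | mixedEmbedding K (x : K) ∈ A}.Finite := by
  have h := ZSpan.setFinite_inter (latticeBasis K) hA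
  refine (h.preimage (f := fun x : 𝓞 K => mixedEmbedding K (x : K)) ?_).subset ?_
  · exact ((mixedEmbedding_injective K).comp RingOfIntegers.coe_injective).injOn
  · intro x hx
    refine ⟨hx, ?_⟩
    rw [SetLike.mem_coe, mem_span_latticeBasis]
    exact ⟨x, rfl⟩

theorem isBounded_affine_image {U : Set (mixedSpace K)} (hU : Bornology.IsBounded U)
    (t v : mixedSpace K) : Bornology.IsBounded ((fun u => t * u + v) '' U) := by
  refine ((hU.isCompact_closure.image (f := fun u => t * u + v) (by fun_prop)).isBounded).subset ?_
  exact Set.image_mono subset_closure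

theorem finite_setOf_mem_affine_image {U : Set (mixedSpace K)} (hU : Bornology.IsBounded U)
    (t v : mixedSpace K) :
    {x : 𝓞 K | mixedEmbedding K (x : K) ∈ (fun u => t * u + v) '' U}.Finite :=
  finite_setOf_mixedEmbedding_mem (isBounded_affine_image hU t v)

theorem card_le_card_affine_image {U : Set (mixedSpace K)} (hU : Bornology.IsBounded U)
    {t v : mixedSpace K} {S : Finset (𝓞 K)}
    (hS : ∀ x ∈ S, mixedEmbedding K (x : K) ∈ (fun u => t * u + v) '' U) :
    S.card ≤ Nat.card {x : 𝓞 K // mixedEmbedding K (x : K) ∈ (fun u => t * u + v) '' U} := by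
  rw [← Set.ncard_coe_finset]
  exact Set.ncard_le_ncard (t := {x : 𝓞 K | _}) hS (finite_setOf_mem_affine_image hU t v)

theorem isUnit_of_norm_ne_zero {t : mixedSpace K} (ht : mixedEmbedding.norm t ≠ 0) :
    IsUnit t := by
  rw [mixedEmbedding.norm_ne_zero_iff] at ht
  rw [Prod.isUnit_iff, Pi.isUnit_iff, Pi.isUnit_iff]
  refine ⟨fun w => ?_, fun w => ?_⟩
  · have := ht w.1
    rw [normAtPlace_apply_of_isReal w.2] at this
    simpa using this
  · have := ht w.1
    rw [normAtPlace_apply_of_isComplex w.2] at this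
    simpa using this

theorem eventually_mem_affine_image {V : Set (mixedSpace K)} (hV : IsOpen V)
    {t v : mixedSpace K} (ht : mixedEmbedding.norm t ≠ 0) {S : Finset (𝓞 K)}
    (hS : ∀ x ∈ S, mixedEmbedding K (x : K) ∈ (fun u => t * u + v) '' V) :
    ∀ᶠ p : mixedSpace K × mixedSpace K in nhds (t, v), mixedEmbedding.norm p.1 ≠ 0 ∧
      ∀ x ∈ S, mixedEmbedding K (x : K) ∈ (fun u => p.1 * u + p.2) '' V := by
  have h1 : ∀ᶠ p : mixedSpace K × mixedSpace K in nhds (t, v), mixedEmbedding.norm p.1 ≠ 0 := by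
    have : Continuous fun p : mixedSpace K × mixedSpace K => mixedEmbedding.norm p.1 := by fun_prop
    exact this.continuousAt.eventually_ne ht
  have h2 : ∀ x ∈ S, ∀ᶠ p : mixedSpace K × mixedSpace K in nhds (t, v),
      Ring.inverse p.1 * (mixedEmbedding K (x : K) - p.2) ∈ V := by
    intro x hx
    obtain ⟨τ, rfl⟩ := isUnit_of_norm_ne_zero ht
    have hc : ContinuousAt (fun p : mixedSpace K × mixedSpace K =>
        Ring.inverse p.1 * (mixedEmbedding K (x : K) - p.2)) ((τ : mixedSpace K), v) := by
      refine ContinuousAt.mul ?_ (by fun_prop)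
      exact ContinuousAt.comp (g := Ring.inverse) (f := Prod.fst)
        (NormedRing.inverse_continuousAt τ) continuousAt_fst
    refine hc.eventually_mem (hV.mem_nhds ?_)
    obtain ⟨u, hu, hux⟩ := hS x hx
    simp only at hux
    rw [← hux]
    simpa using hu
  filter_upwards [h1, (Filter.eventually_all_finset S).2 h2] with p hp1 hp2
  refine ⟨hp1, fun x hx => ⟨_, hp2 x hx, ?_⟩⟩
  simp only
  rw [← mul_assoc, Ring.mul_inverse_cancel _ (isUnit_of_norm_ne_zero hp1)]
  simp

theorem exists_isOpen_prod_of_eventually {X Y : Type*} [TopologicalSpace X] [TopologicalSpace Y]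
    {P : X × Y → Prop} {a : X} {b : Y} (h : ∀ᶠ p in nhds (a, b), P p) :
    ∃ T W, IsOpen T ∧ a ∈ T ∧ IsOpen W ∧ b ∈ W ∧ ∀ x ∈ T, ∀ y ∈ W, P (x, y) := by
  obtain ⟨T, W, hT, ha, hW, hb, hTW⟩ := mem_nhds_prod_iff'.1 h
  exact ⟨T, W, hT, ha, hW, hb, fun x hx y hy => hTW (Set.mk_mem_prod hx hy)⟩

theorem hasLargeDiscrepancy_of_lt_card {U : Set (mixedSpace K)} (hU : Bornology.IsBounded U)
    {t v : mixedSpace K} (ht : mixedEmbedding.norm t ≠ 0) {S : Finset (𝓞 K)}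
    (hS : ∀ x ∈ S, mixedEmbedding K (x : K) ∈ (fun u => t * u + v) '' interior U)
    (hcard : 1 + density K U * mixedEmbedding.norm t < S.card) : HasLargeDiscrepancy K U := by
  set δ := (S.card - (1 + density K U * mixedEmbedding.norm t)) / 2 with hδ
  have h1 : ∀ᶠ p : mixedSpace K × mixedSpace K in nhds (t, v),
      1 + δ + density K U * mixedEmbedding.norm p.1 < S.card := by
    have : Continuous fun p : mixedSpace K × mixedSpace K =>
      1 + δ + density K U * mixedEmbedding.norm p.1 := by fun_prop
    refine this.continuousAt.eventually_lt_const ?_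
    simp only
    linarith
  obtain ⟨T, W, hT, htT, hW, hvW, hTW⟩ := exists_isOpen_prod_of_eventually
    (P := fun p : mixedSpace K × mixedSpace K =>
      1 + δ + density K U * mixedEmbedding.norm p.1 < S.card ∧ mixedEmbedding.norm p.1 ≠ 0 ∧
        ∀ x ∈ S, mixedEmbedding K (x : K) ∈ (fun u => p.1 * u + p.2) '' interior U)
    (h1.and (eventually_mem_affine_image isOpen_interior ht hS))
  refine ⟨δ, by linarith, T, W, hT, ⟨t, htT⟩, hW, ⟨v, hvW⟩, fun s hs => (hTW s hs v hvW).2.1,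
    fun s hs w hw => ?_⟩
  obtain ⟨h2, -, h4⟩ := hTW s hs w hw
  have h5 := card_le_card_affine_image hU
    fun x hx => Set.image_mono interior_subset (h4 x hx)
  rw [← Nat.cast_le (α := ℝ)] at h5
  exact lt_sub_iff_add_lt.2 (h2.trans_le h5)

theorem card_lt_of_not_hasLargeDiscrepancy {U : Set (mixedSpace K)} (hU : Bornology.IsBounded U)
    (hc : 0 < density K U) (hl : ¬ HasLargeDiscrepancy K U)
    {t v : mixedSpace K} (ht : mixedEmbedding.norm t ≠ 0) {S : Finset (𝓞 K)}
    (hS : ∀ x ∈ S, mixedEmbedding K (x : K) ∈ (fun u => t * u + v) '' interior U) :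
    (S.card : ℝ) < 1 + density K U * mixedEmbedding.norm t := by
  by_contra! hcard
  refine hl ?_
  have h1 : Filter.Tendsto (fun ε : ℝ => ((1 - ε) • t, v)) (nhdsWithin 0 (Set.Ioi 0))
      (nhds (t, v)) := by
    refine Filter.Tendsto.mono_left (Continuous.tendsto' (by fun_prop) _ _ (by simp))
      nhdsWithin_le_nhds
  have h2 : ∀ᶠ ε : ℝ in nhdsWithin 0 (Set.Ioi 0), ε ∈ Set.Ioo (0 : ℝ) 1 :=
    Ioo_mem_nhdsGT one_pos
  obtain ⟨ε, ⟨h3, h4⟩, h5⟩ :=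
    ((h1.eventually (eventually_mem_affine_image isOpen_interior ht hS)).and h2).exists
  refine hasLargeDiscrepancy_of_lt_card hU h3 h4 (lt_of_lt_of_le ?_ hcard)
  rw [mixedEmbedding.norm_smul, abs_of_nonneg (by linarith [h5.2])]
  have h6 : (1 - ε) ^ Module.finrank ℚ K < 1 :=
    pow_lt_one₀ (by linarith [h5.2]) (by linarith [h5.1]) Module.finrank_pos.ne'
  have h7 : 0 < mixedEmbedding.norm t := (mixedEmbedding.norm_nonneg t).lt_of_ne' ht
  have : (1 - ε) ^ Module.finrank ℚ K * mixedEmbedding.norm t < 1 * mixedEmbedding.norm t := by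
    gcongr
  nlinarith

theorem ae_forall_notMem_affine_image {Z : Set (mixedSpace K)} (hZ : volume Z = 0)
    (t : mixedSpace K) :
    ∀ᵐ v : mixedSpace K, ∀ x : 𝓞 K, mixedEmbedding K (x : K) ∉ (fun u => t * u + v) '' Z := by
  have : Countable (𝓞 K) := by
    have : Function.Injective fun x : 𝓞 K =>
        (⟨mixedEmbedding K (x : K), ⟨x, rfl⟩⟩ : mixedEmbedding.integerLattice K) := fun x y h =>
      RingOfIntegers.coe_injective (mixedEmbedding_injective K (congrArg Subtype.val h))
    exact this.countable
  refine ae_all_iff.2 fun x => ?_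
  have h1 : volume ((LinearMap.mulLeft ℝ (-t)) '' Z) = 0 := by
    rw [Measure.addHaar_image_linearMap, hZ, mul_zero]
  have h2 := (measurePreserving_sub_right volume
    (mixedEmbedding K (x : K))).quasiMeasurePreserving.preimage_null h1
  refine measure_mono_null ?_ h2
  rintro v hv
  obtain ⟨u, hu, hux⟩ := not_not.1 hv
  refine ⟨u, hu, ?_⟩
  simp only at hux
  rw [← hux]
  simp

theorem maxDiscrep_lt_one_of_ae_le {U : Set (mixedSpace K)} {t : mixedSpace K} {ρ : ℝ}
    (hρ : ρ < 1) (h : ∀ᵐ v, |discrep K U t v| ≤ ρ) : maxDiscrep K U t < 1 := by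
  refine (essSup_le_of_ae_le (ρ : EReal) ?_).trans_lt (by exact_mod_cast hρ)
  filter_upwards [h] with v hv
  exact_mod_cast hv

theorem maxDiscrep_lt_one_of_ae_lt {U : Set (mixedSpace K)} {t : mixedSpace K}
    (h : ∀ᵐ v, |discrep K U t v| < 1) : maxDiscrep K U t < 1 := by
  set a := density K U * mixedEmbedding.norm t with ha
  have h1 := Int.floor_le a
  have h2 := Int.lt_floor_add_one a
  have h3 := Int.le_ceil a
  have h4 := Int.ceil_lt_add_one a
  refine maxDiscrep_lt_one_of_ae_le (ρ := max (a - ⌊a⌋) (⌈a⌉ - a))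
    (max_lt (by linarith) (by linarith)) ?_
  filter_upwards [h] with v hv
  unfold discrep at hv ⊢
  change |_ - a| < 1 at hv
  change |_ - a| ≤ _
  set m := Nat.card {x : 𝓞 K // mixedEmbedding K (x : K) ∈ (fun u => t * u + v) '' U}
  rw [abs_lt] at hv
  have h5 : ⌊a⌋ ≤ (m : ℤ) := by
    rw [← Int.lt_add_one_iff, ← Int.cast_lt (R := ℝ)]
    push_cast
    linarith
  have h6 : (m : ℤ) ≤ ⌈a⌉ := by
    rw [← Int.lt_add_one_iff, ← Int.cast_lt (R := ℝ)]
    push_cast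
    linarith
  have h7 : (⌊a⌋ : ℝ) ≤ m := by exact_mod_cast h5
  have h8 : (m : ℝ) ≤ ⌈a⌉ := by exact_mod_cast h6
  rw [abs_le]
  exact ⟨by linarith [le_max_left (a - ⌊a⌋) (⌈a⌉ - a)],
    by linarith [le_max_right (a - ⌊a⌋) (⌈a⌉ - a)]⟩

theorem maxDiscrep_lt_one_of_volume_eq_zero {U : Set (mixedSpace K)} (hU : volume U = 0)
    (t : mixedSpace K) : maxDiscrep K U t < 1 := by
  refine maxDiscrep_lt_one_of_ae_le (ρ := 0) one_pos ?_
  filter_upwards [ae_forall_notMem_affine_image hU t] with v hv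
  have : IsEmpty {x : 𝓞 K // mixedEmbedding K (x : K) ∈ (fun u => t * u + v) '' U} :=
    Subtype.isEmpty_of_false fun x => hv x
  rw [discrep, Nat.card_of_isEmpty]
  simp [hU]

/-- If every translate of `A` contains at most `M` lattice points, then `A` is covered at most `M`
times by a fundamental domain. -/
theorem setLIntegral_le_of_card_le {A : Set (mixedSpace K)} (hA : MeasurableSet A) {M : ℕ}
    (hM : ∀ (v : mixedSpace K) (S : Finset (𝓞 K)),
      (∀ x ∈ S, mixedEmbedding K (x : K) + v ∈ A) → S.card ≤ M)
    {w : mixedSpace K → ENNReal} (hw : Measurable w)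
    (hper : ∀ (x : 𝓞 K) (v : mixedSpace K), w (mixedEmbedding K (x : K) + v) = w v) :
    ∫⁻ v in A, w v ≤ M * ∫⁻ v in ZSpan.fundamentalDomain (latticeBasis K), w v := by
  have : VAddInvariantMeasure (mixedEmbedding.integerLattice K) (mixedSpace K) volume :=
    inferInstanceAs (VAddInvariantMeasure (mixedEmbedding.integerLattice K).toAddSubgroup _ _)
  have hperL (g : mixedEmbedding.integerLattice K) (v : mixedSpace K) : w (g + v) = w v := by
    obtain ⟨_, x, rfl⟩ := g
    exact hper x v
  have hmeas (g : mixedEmbedding.integerLattice K) :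
      Measurable fun v : mixedSpace K => A.indicator w (g +ᵥ v) :=
    (hw.indicator hA).comp (measurable_const_add (g : mixedSpace K))
  rw [← lintegral_indicator hA, (fundamentalDomain_integerLattice K).lintegral_eq_tsum'',
    ← lintegral_tsum (fun g => (hmeas g).aemeasurable), ← lintegral_const_mul _ hw]
  refine lintegral_mono fun v => ?_
  rw [ENNReal.tsum_eq_iSup_sum]
  refine iSup_le fun s => ?_
  have h1 : ∑ g ∈ s, A.indicator w (g +ᵥ v) =
      (s.filter fun g : mixedEmbedding.integerLattice K =>
        (g : mixedSpace K) + v ∈ A).card * w v := by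
    rw [← nsmul_eq_mul, ← Finset.sum_const, Finset.sum_filter]
    refine Finset.sum_congr rfl fun g _ => ?_
    rw [Set.indicator_apply, Submodule.vadd_def, vadd_eq_add, hperL]
  rw [h1]
  gcongr
  choose e he using fun g : mixedEmbedding.integerLattice K => g.2
  have he' (g : mixedEmbedding.integerLattice K) :
      mixedEmbedding K (e g : K) = (g : mixedSpace K) := he g
  have hinj : Function.Injective e := fun g g' h => Subtype.ext (by rw [← he', h, he'])
  rw [← Finset.card_image_of_injective _ hinj]
  refine hM v _ fun x hx => ?_
  obtain ⟨g, hg, rfl⟩ := Finset.mem_image.1 hx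
  rw [he']
  exact (Finset.mem_filter.1 hg).2

open scoped Pointwise

theorem measureReal_fundamentalDomain_latticeBasis :
    volume.real (ZSpan.fundamentalDomain (latticeBasis K)) =
      2⁻¹ ^ nrComplexPlaces K * Real.sqrt |(discr K : ℝ)| := by
  rw [measureReal_def, volume_fundamentalDomain_latticeBasis]
  simp [Int.norm_eq_abs]

theorem card_le_of_forall_mem_smul {U : Set (mixedSpace K)} (hU : Bornology.IsBounded U)
    (hc : 0 < density K U) (hl : ¬ HasLargeDiscrepancy K U) {s : ℝ} (hs : 0 < s) {k : ℕ}
    (hk : density K U * s ^ Module.finrank ℚ K = k) (v : mixedSpace K) (S : Finset (𝓞 K))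
    (hS : ∀ x ∈ S, mixedEmbedding K (x : K) + v ∈ s • interior U) : S.card ≤ k := by
  have hnorm : mixedEmbedding.norm (s • (1 : mixedSpace K)) = s ^ Module.finrank ℚ K := by
    rw [mixedEmbedding.norm_smul, map_one, mul_one, abs_of_pos hs]
  have h := card_lt_of_not_hasLargeDiscrepancy hU hc hl (t := s • (1 : mixedSpace K)) (v := -v)
    (S := S) (by rw [hnorm]; positivity) fun x hx => by
      obtain ⟨u, hu, hux⟩ := Set.mem_smul_set.1 (hS x hx)
      refine ⟨u, hu, ?_⟩
      simp only [smul_mul_assoc, one_mul, hux]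
      abel
  rw [hnorm, hk] at h
  have : S.card < 1 + k := by exact_mod_cast h
  omega

theorem measureReal_smul_interior {U : Set (mixedSpace K)} (hUfr : volume (frontier U) = 0)
    {s : ℝ} (hs : 0 < s) : volume.real (s • interior U) =
      density K U * s ^ Module.finrank ℚ K * Real.sqrt |(discr K : ℝ)| := by
  rw [measureReal_def, Measure.addHaar_smul, measure_congr (interior_ae_eq_of_null_frontier hUfr),
    mixedEmbedding.finrank, ENNReal.toReal_mul, ENNReal.toReal_ofReal (abs_nonneg _),
    abs_of_pos (pow_pos hs _), density]
  field_simp [(sqrt_abs_discr_pos K).ne']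

theorem exists_pos_mul_pow_eq {c : ℝ} (hc : 0 < c) {n : ℕ} (hn : n ≠ 0) {k : ℝ} (hk : 0 < k) :
    ∃ s : ℝ, 0 < s ∧ c * s ^ n = k := by
  refine ⟨(k / c) ^ (n⁻¹ : ℝ), by positivity, ?_⟩
  rw [Real.rpow_inv_natCast_pow (by positivity) hn]
  field_simp

theorem nrComplexPlaces_eq_zero {U : Set (mixedSpace K)} (hU : Bornology.IsBounded U)
    (hUfr : volume (frontier U) = 0)
    (hc : 0 < density K U) (hl : ¬ HasLargeDiscrepancy K U) :
    nrComplexPlaces K = 0 := by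
  obtain ⟨s, hs, hsk⟩ := exists_pos_mul_pow_eq hc (Module.finrank_pos (R := ℚ) (M := K)).ne'
    (k := ((1 : ℕ) : ℝ)) (by norm_num)
  have h := setLIntegral_le_of_card_le (isOpen_interior.smul₀ hs.ne').measurableSet
    (card_le_of_forall_mem_smul hU hc hl hs hsk) (w := fun _ => 1) measurable_const
    (fun _ _ => rfl)
  rw [setLIntegral_one, setLIntegral_one, Nat.cast_one, one_mul] at h
  have h2 := ENNReal.toReal_mono (ZSpan.fundamentalDomain_isBounded _).measure_lt_top.ne h
  rw [← measureReal_def, ← measureReal_def, measureReal_smul_interior hUfr hs, hsk,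
    measureReal_fundamentalDomain_latticeBasis, Nat.cast_one,
    mul_le_mul_iff_left₀ (sqrt_abs_discr_pos K)] at h2
  by_contra h3
  exact absurd h2 (not_le.2 (pow_lt_one₀ (by norm_num) (by norm_num) h3))

theorem measurable_latticeBasis_repr (i) :
    Measurable fun v : mixedSpace K => (latticeBasis K).repr v i :=
  (LinearMap.continuous_of_finiteDimensional ((latticeBasis K).coord i)).measurable

theorem exists_int_latticeBasis_repr_eq (x : 𝓞 K) (i) :
    ∃ m : ℤ, (latticeBasis K).repr (mixedEmbedding K (x : K)) i = m := by
  have h : mixedEmbedding K (x : K) ∈ Submodule.span ℤ (Set.range (latticeBasis K)) := by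
    rw [mem_span_latticeBasis]
    exact ⟨x, rfl⟩
  rw [Module.Basis.mem_span_iff_repr_mem] at h
  obtain ⟨m, hm⟩ := h i
  exact ⟨m, hm.symm⟩

theorem setLIntegral_fundamentalDomain_comp_add {w : mixedSpace K → ENNReal}
    (hper : ∀ (x : 𝓞 K) (v : mixedSpace K), w (mixedEmbedding K (x : K) + v) = w v)
    (a : mixedSpace K) :
    ∫⁻ v in ZSpan.fundamentalDomain (latticeBasis K), w (a + v) =
      ∫⁻ v in ZSpan.fundamentalDomain (latticeBasis K), w v := by
  have : VAddInvariantMeasure (mixedEmbedding.integerLattice K) (mixedSpace K) volume :=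
    inferInstanceAs (VAddInvariantMeasure (mixedEmbedding.integerLattice K).toAddSubgroup _ _)
  have : VAddCommClass (mixedSpace K) (mixedEmbedding.integerLattice K) (mixedSpace K) :=
    ⟨fun x y z => by
      simp only [Submodule.vadd_def, vadd_eq_add]
      abel⟩
  have h1 := (fundamentalDomain_integerLattice K).vadd_of_comm a
  have h2 := (fundamentalDomain_integerLattice K).setLIntegral_eq h1 w fun g v => by
    obtain ⟨_, x, rfl⟩ := g
    exact hper x v
  have h3 : (fun v => a + v) ⁻¹' (a +ᵥ ZSpan.fundamentalDomain (latticeBasis K)) =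
      ZSpan.fundamentalDomain (latticeBasis K) :=
    Set.preimage_image_eq _ (add_right_injective a)
  have h4 := (measurePreserving_add_left volume a).setLIntegral_comp_preimage_emb
    (measurableEmbedding_addLeft a) w (a +ᵥ ZSpan.fundamentalDomain (latticeBasis K))
  rw [h2, ← h4, h3]

/-- `1 + ε cos (2π v_i)` in lattice coordinates, as a nonnegative weight. -/
noncomputable def cosWeight (i : Module.Free.ChooseBasisIndex ℤ (𝓞 K)) (ε : ℝ)
    (v : mixedSpace K) : ENNReal :=
  ENNReal.ofReal (1 + ε * Real.cos (2 * Real.pi * (latticeBasis K).repr v i))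

theorem measurable_cosWeight (i) (ε : ℝ) : Measurable (cosWeight (K := K) i ε) := by
  have := measurable_latticeBasis_repr (K := K) i
  unfold cosWeight
  fun_prop

theorem cosWeight_add (i) (ε : ℝ) (x : 𝓞 K) (v : mixedSpace K) :
    cosWeight i ε (mixedEmbedding K (x : K) + v) = cosWeight i ε v := by
  obtain ⟨m, hm⟩ := exists_int_latticeBasis_repr_eq x i
  rw [cosWeight, cosWeight, map_add, Finsupp.add_apply, hm, mul_add, mul_comm _ (m : ℝ), add_comm,
    add_comm _ (2 * Real.pi * _), Real.cos_add_int_mul_two_pi]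
  ring_nf

theorem cosWeight_half_add (i) (ε : ℝ) (v : mixedSpace K) :
    cosWeight i ε ((1 / 2 : ℝ) • latticeBasis K i + v) = cosWeight i (-ε) v := by
  rw [cosWeight, cosWeight, map_add, Finsupp.add_apply, map_smul, Finsupp.smul_apply,
    Module.Basis.repr_self, Finsupp.single_eq_same, mul_add, add_comm (2 * Real.pi * _)]
  simp only [smul_eq_mul, mul_one]
  rw [show 2 * Real.pi * (1 / 2) = Real.pi by ring, Real.cos_add_pi]
  ring_nf

theorem setLIntegral_cosWeight (i) {ε : ℝ} (hε : |ε| ≤ 1) :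
    ∫⁻ v in ZSpan.fundamentalDomain (latticeBasis K), cosWeight i ε v =
      volume (ZSpan.fundamentalDomain (latticeBasis K)) := by
  have h1 := setLIntegral_fundamentalDomain_comp_add (cosWeight_add (K := K) i ε)
    ((1 / 2 : ℝ) • latticeBasis K i)
  simp only [cosWeight_half_add] at h1
  have h2 : ∀ v : mixedSpace K, cosWeight i ε v + cosWeight i (-ε) v = 2 := fun v => by
    have h3 := abs_le.1 ((abs_mul ε _).trans_le (mul_le_one₀ hε (abs_nonneg _)
      (Real.abs_cos_le_one (2 * Real.pi * (latticeBasis K).repr v i))))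
    rw [cosWeight, cosWeight, ← ENNReal.ofReal_add (by linarith) (by linarith)]
    ring_nf
    simp
  have h4 := lintegral_add_left (μ := volume.restrict (ZSpan.fundamentalDomain (latticeBasis K)))
    (measurable_cosWeight i ε) (cosWeight i (-ε))
  simp only [h2, h1] at h4
  rw [setLIntegral_const, ← two_mul] at h4
  exact ((ENNReal.mul_right_inj two_ne_zero ENNReal.ofNat_ne_top).1 h4).symm

theorem setIntegral_cos_eq_zero (hr : nrComplexPlaces K = 0) {U : Set (mixedSpace K)}
    (hU : Bornology.IsBounded U) (hUfr : volume (frontier U) = 0) (hc : 0 < density K U)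
    (hl : ¬ HasLargeDiscrepancy K U) {s : ℝ} (hs : 0 < s) {k : ℕ}
    (hk : density K U * s ^ Module.finrank ℚ K = k) (i) :
    ∫ v in interior U, Real.cos (s * (2 * Real.pi * (latticeBasis K).repr v i)) = 0 := by
  have hA : MeasurableSet (s • interior U) := (isOpen_interior.smul₀ hs.ne').measurableSet
  have hAb : Bornology.IsBounded (s • interior U) := (hU.subset interior_subset).smul₀ s
  have hvol : volume.real (s • interior U) =
      k * volume.real (ZSpan.fundamentalDomain (latticeBasis K)) := by
    rw [measureReal_smul_interior hUfr hs, hk, measureReal_fundamentalDomain_latticeBasis, hr]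
    simp
  have hfin : IsFiniteMeasure (volume.restrict (s • interior U)) :=
    isFiniteMeasure_restrict.2 hAb.measure_lt_top.ne
  have hcos : Integrable (fun v : mixedSpace K =>
      Real.cos (2 * Real.pi * (latticeBasis K).repr v i))
      (volume.restrict (s • interior U)) := by
    refine Integrable.of_bound (C := 1) ?_ (Filter.Eventually.of_forall fun v => ?_)
    · have := measurable_latticeBasis_repr (K := K) i
      exact Measurable.aestronglyMeasurable (by fun_prop)
    · exact Real.abs_cos_le_one _
  have key (ε : ℝ) (hε : |ε| ≤ 1) :
      ε * ∫ v in s • interior U, Real.cos (2 * Real.pi * (latticeBasis K).repr v i) ≤ 0 := by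
    have h1 := setLIntegral_le_of_card_le hA (card_le_of_forall_mem_smul hU hc hl hs hk)
      (measurable_cosWeight i ε) (cosWeight_add i ε)
    rw [setLIntegral_cosWeight i hε] at h1
    have h2 := ENNReal.toReal_mono (ENNReal.mul_ne_top (ENNReal.natCast_ne_top k)
      (ZSpan.fundamentalDomain_isBounded (latticeBasis K)).measure_lt_top.ne) h1
    rw [ENNReal.toReal_mul, ENNReal.toReal_natCast, ← measureReal_def, ← hvol] at h2
    unfold cosWeight at h2
    rw [← integral_eq_lintegral_of_nonneg_ae, integral_add, integral_const_mul] at h2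
    · simp at h2
      linarith
    · exact integrable_const 1
    · exact hcos.const_mul ε
    · refine Filter.Eventually.of_forall fun v => ?_
      have h3 := abs_le.1 ((abs_mul ε _).trans_le (mul_le_one₀ hε (abs_nonneg _)
        (Real.abs_cos_le_one (2 * Real.pi * (latticeBasis K).repr v i))))
      simp only [Pi.zero_apply]
      linarith
    · have := measurable_latticeBasis_repr (K := K) i
      exact Measurable.aestronglyMeasurable (by fun_prop)
  have h0 : ∫ v in s • interior U, Real.cos (2 * Real.pi * (latticeBasis K).repr v i) = 0 := by
    have h1 := key 1 (by simp)
    have h2 := key (-1) (by simp)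
    linarith
  have h5 := Measure.setIntegral_comp_smul_of_pos volume
    (fun v : mixedSpace K => Real.cos (2 * Real.pi * (latticeBasis K).repr v i)) (interior U) hs
  rw [h0, smul_zero] at h5
  rw [← h5]
  congr 1 with v
  rw [map_smul, Finsupp.smul_apply, smul_eq_mul]
  ring_nf

theorem finrank_le_one_of_not_hasLargeDiscrepancy {U : Set (mixedSpace K)}
    (hU : Bornology.IsBounded U) (hUfr : volume (frontier U) = 0)
    (hc : 0 < density K U) (hl : ¬ HasLargeDiscrepancy K U) :
    Module.finrank ℚ K ≤ 1 := by
  by_contra! hn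
  have hr := nrComplexPlaces_eq_zero hU hUfr hc hl
  obtain ⟨i⟩ : Nonempty (Module.Free.ChooseBasisIndex ℤ (𝓞 K)) := inferInstance
  have hfin : IsFiniteMeasure (volume.restrict (interior U)) :=
    ⟨by simpa using (hU.subset interior_subset).measure_lt_top⟩
  have hbd : Bornology.IsBounded ((fun v : mixedSpace K =>
      2 * Real.pi * (latticeBasis K).repr v i) '' interior U) := by
    refine ((hU.isCompact_closure.image (f := fun v : mixedSpace K =>
      2 * Real.pi * (latticeBasis K).repr v i) ?_).isBounded).subset
        (Set.image_mono (interior_subset.trans subset_closure))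
    exact continuous_const.mul
      (LinearMap.continuous_of_finiteDimensional ((latticeBasis K).coord i))
  obtain ⟨B, hB⟩ := isBounded_iff_forall_norm_le.1 hbd
  have h := measure_univ_eq_zero_of_integral_cos_eq_zero (volume.restrict (interior U))
    (f := fun v : mixedSpace K => 2 * Real.pi * (latticeBasis K).repr v i)
    ((measurable_latticeBasis_repr i).const_mul _) (B := B)
    ((ae_restrict_iff' isOpen_interior.measurableSet).2 <| Filter.Eventually.of_forall
      fun v hv => hB _ ⟨v, hv, rfl⟩) hc hn
    fun k _ s hs hk => setIntegral_cos_eq_zero hr hU hUfr hc hl hs hk i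
  rw [Measure.restrict_apply_univ, measure_congr (interior_ae_eq_of_null_frontier hUfr)] at h
  simp [density, h] at hc
theorem exists_smul_one_eq (hn : Module.finrank ℚ K = 1) (v : mixedSpace K) :
    ∃ a : ℝ, a • (1 : mixedSpace K) = v := by
  have h : Module.finrank ℝ (mixedSpace K) = 1 := by rw [mixedEmbedding.finrank, hn]
  exact (finrank_eq_one_iff_of_nonzero' (1 : mixedSpace K) one_ne_zero).1 h v

theorem norm_smul_one (hn : Module.finrank ℚ K = 1) (a : ℝ) :
    mixedEmbedding.norm (a • (1 : mixedSpace K)) = |a| := by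
  rw [mixedEmbedding.norm_smul, map_one, mul_one, hn, pow_one]

theorem eq_of_norm_sub_lt_one {x y : 𝓞 K}
    (h : mixedEmbedding.norm (mixedEmbedding K (x : K) - mixedEmbedding K (y : K)) < 1) :
    x = y := by
  rw [← map_sub, ← map_sub (algebraMap (𝓞 K) K), norm_eq_norm, ← Algebra.coe_norm_int] at h
  have h1 : |Algebra.norm ℤ (x - y)| < 1 := by exact_mod_cast h
  rw [Int.abs_lt_one_iff, Algebra.norm_eq_zero_iff, sub_eq_zero] at h1
  exact h1

theorem volume_image_Icc_zero_one_le (hn : Module.finrank ℚ K = 1) :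
    volume ((fun a : ℝ => a • (1 : mixedSpace K)) '' Set.Icc 0 1) ≤
      volume (ZSpan.fundamentalDomain (latticeBasis K)) := by
  have hmeas : MeasurableSet ((fun a : ℝ => a • (1 : mixedSpace K)) '' Set.Icc 0 1) :=
    (isCompact_Icc.image (by fun_prop)).isClosed.measurableSet
  have h := setLIntegral_le_of_card_le (hmeas.diff (measurableSet_singleton (1 : mixedSpace K)))
    (M := 1) (fun v S hS => Finset.card_le_one.2 fun x hx y hy => ?_) (w := fun _ => 1)
    measurable_const (fun _ _ => rfl)
  · rwa [setLIntegral_one, setLIntegral_one, Nat.cast_one, one_mul,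
      measure_sdiff_null (measure_singleton _)] at h
  · obtain ⟨⟨a, ha, hax⟩, ha1⟩ := hS x hx
    obtain ⟨⟨b, hb, hby⟩, hb1⟩ := hS y hy
    simp only at hax hby
    have ha2 : a ≠ 1 := fun h => ha1 (by rw [← hax, h, one_smul]; rfl)
    have hb2 : b ≠ 1 := fun h => hb1 (by rw [← hby, h, one_smul]; rfl)
    refine eq_of_norm_sub_lt_one ?_
    rw [← add_sub_add_right_eq_sub _ _ v, ← hax, ← hby, ← sub_smul, norm_smul_one hn, abs_lt]
    have := lt_of_le_of_ne ha.2 ha2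
    have := lt_of_le_of_ne hb.2 hb2
    constructor <;> linarith [ha.1, hb.1]

theorem volume_image_Icc_le (hn : Module.finrank ℚ K = 1) (α : ℝ) {c : ℝ} (hc : 0 < c) :
    volume ((fun a : ℝ => a • (1 : mixedSpace K)) '' Set.Icc α (α + c)) ≤
      ENNReal.ofReal c * volume (ZSpan.fundamentalDomain (latticeBasis K)) := by
  have h : (fun a : ℝ => a • (1 : mixedSpace K)) '' Set.Icc α (α + c) ⊆
      (α • (1 : mixedSpace K)) +ᵥ c • ((fun a : ℝ => a • (1 : mixedSpace K)) '' Set.Icc 0 1) := by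
    rintro _ ⟨a, ha, rfl⟩
    refine ⟨c • ((a - α) / c) • 1, ⟨_, ⟨_, ⟨?_, ?_⟩, rfl⟩, rfl⟩, ?_⟩
    · exact div_nonneg (by linarith [ha.1]) hc.le
    · rw [div_le_one hc]
      linarith [ha.2]
    · simp only [vadd_eq_add]
      rw [smul_smul, mul_div_cancel₀ _ hc.ne', ← add_smul]
      ring_nf
  refine (measure_mono h).trans ?_
  rw [measure_vadd, Measure.addHaar_smul, mixedEmbedding.finrank, hn, pow_one, abs_of_pos hc]
  exact mul_le_mul_right (volume_image_Icc_zero_one_le hn) _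

theorem sub_lt_density {U : Set (mixedSpace K)} (hU : Bornology.IsBounded U)
    (hn : Module.finrank ℚ K = 1) (hc : 0 < density K U) (hl : ¬ HasLargeDiscrepancy K U) {a b : ℝ}
    (ha : a • (1 : mixedSpace K) ∈ interior U) (hb : b • (1 : mixedSpace K) ∈ interior U) :
    b - a < density K U := by
  rcases le_or_gt b a with hab | hab
  · linarith
  have hd : 0 < b - a := by linarith
  have h := card_lt_of_not_hasLargeDiscrepancy hU hc hl (t := (b - a)⁻¹ • (1 : mixedSpace K))
    (v := -(((b - a)⁻¹ * a) • (1 : mixedSpace K))) (S := {0, 1}) (by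
      rw [norm_smul_one hn]
      positivity) (by
      intro x hx
      simp only [Finset.mem_insert, Finset.mem_singleton] at hx
      rcases hx with rfl | rfl
      · refine ⟨_, ha, ?_⟩
        simp [smul_smul, mul_comm a]
      · refine ⟨_, hb, ?_⟩
        simp only [smul_mul_assoc, one_mul, smul_smul, ← sub_eq_add_neg, ← sub_smul, ← mul_sub]
        rw [inv_mul_cancel₀ hd.ne']
        simp)
  rw [norm_smul_one hn, abs_of_pos (inv_pos.2 hd), Finset.card_pair zero_ne_one,
    ← div_eq_mul_inv] at h
  push_cast at h
  have h1 : 1 < density K U / (b - a) := by linarith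
  rwa [one_lt_div hd] at h1

theorem exists_interior_subset_image_Icc {U : Set (mixedSpace K)} (hU : Bornology.IsBounded U)
    (hUfr : volume (frontier U) = 0) (hn : Module.finrank ℚ K = 1)
    (hc : 0 < density K U) (hl : ¬ HasLargeDiscrepancy K U) :
    ∃ α : ℝ, interior U ⊆
      (fun a : ℝ => a • (1 : mixedSpace K)) '' Set.Icc α (α + density K U) := by
  have hne : (interior U).Nonempty := by
    by_contra! h
    have h1 := measure_congr (interior_ae_eq_of_null_frontier hUfr)
    rw [h, measure_empty] at h1
    simp [density, ← h1] at hc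
  set S : Set ℝ := {a | a • (1 : mixedSpace K) ∈ interior U} with hS
  obtain ⟨v₀, hv₀⟩ := hne
  obtain ⟨a₀, rfl⟩ := exists_smul_one_eq hn v₀
  have hbdd : BddBelow S := ⟨a₀ - density K U, fun b hb => by
    linarith [sub_lt_density hU hn hc hl hb hv₀]⟩
  refine ⟨sInf S, fun v hv => ?_⟩
  obtain ⟨a, rfl⟩ := exists_smul_one_eq hn v
  refine ⟨a, ⟨csInf_le hbdd hv, ?_⟩, rfl⟩
  have : a - density K U ≤ sInf S := le_csInf ⟨a₀, hv₀⟩ fun b hb => by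
    linarith [sub_lt_density hU hn hc hl hb hv]
  linarith

theorem lt_card_Icc_ceil_floor (p q : ℝ) : q - p - 1 < (Finset.Icc ⌈p⌉ ⌊q⌋).card := by
  rw [Int.card_Icc]
  have h1 := Int.lt_floor_add_one q
  have h2 := Int.ceil_lt_add_one p
  have h3 : ((⌊q⌋ + 1 - ⌈p⌉ : ℤ) : ℝ) ≤ ((⌊q⌋ + 1 - ⌈p⌉).toNat : ℝ) := by
    exact_mod_cast Int.self_le_toNat _
  push_cast at h3
  linarith

/-- An interval of length `c` scaled by `τ` and translated by `β` contains more than `c|τ| - 1`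
integers. -/
theorem exists_finset_int_lt_card (α β : ℝ) {c τ : ℝ} (hτ : τ ≠ 0) :
    ∃ S : Finset ℤ, c * |τ| - 1 < S.card ∧ ∀ m ∈ S, (m - β) / τ ∈ Set.Icc α (α + c) := by
  rcases hτ.lt_or_gt with h | h
  · refine ⟨Finset.Icc ⌈τ * (α + c) + β⌉ ⌊τ * α + β⌋, ?_, fun m hm => ?_⟩
    · refine (le_of_eq ?_).trans_lt (lt_card_Icc_ceil_floor _ _)
      rw [abs_of_neg h]
      ring
    · rw [Finset.mem_Icc, Int.ceil_le, Int.le_floor] at hm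
      exact ⟨(le_div_iff_of_neg h).2 (by linarith), (div_le_iff_of_neg h).2 (by linarith)⟩
  · refine ⟨Finset.Icc ⌈τ * α + β⌉ ⌊τ * (α + c) + β⌋, ?_, fun m hm => ?_⟩
    · refine (le_of_eq ?_).trans_lt (lt_card_Icc_ceil_floor _ _)
      rw [abs_of_pos h]
      ring
    · rw [Finset.mem_Icc, Int.ceil_le, Int.le_floor] at hm
      exact ⟨(le_div_iff₀ h).2 (by linarith), (div_le_iff₀ h).2 (by linarith)⟩

theorem maxDiscrep_lt_one_of_finrank_eq_one {U : Set (mixedSpace K)} (hU : Bornology.IsBounded U)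
    (hUfr : volume (frontier U) = 0) (hn : Module.finrank ℚ K = 1)
    (hc : 0 < density K U) (hl : ¬ HasLargeDiscrepancy K U) {t : mixedSpace K}
    (ht : mixedEmbedding.norm t ≠ 0) : maxDiscrep K U t < 1 := by
  obtain ⟨α, hα⟩ := exists_interior_subset_image_Icc hU hUfr hn hc hl
  set J := (fun a : ℝ => a • (1 : mixedSpace K)) '' Set.Icc α (α + density K U)
  have hint := interior_ae_eq_of_null_frontier hUfr
  have hUtop : volume (interior U) ≠ ⊤ := (hU.subset interior_subset).measure_lt_top.ne
  have hJle : volume J ≤ volume (interior U) := by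
    refine (volume_image_Icc_le hn α hc).trans (le_of_eq ?_)
    rw [← ENNReal.toReal_eq_toReal_iff' (ENNReal.mul_ne_top ENNReal.ofReal_ne_top
      (ZSpan.fundamentalDomain_isBounded (latticeBasis K)).measure_lt_top.ne) hUtop,
      ENNReal.toReal_mul, ENNReal.toReal_ofReal hc.le, ← measureReal_def,
      measureReal_fundamentalDomain_latticeBasis, nrComplexPlaces_eq_zero hU hUfr hc hl, pow_zero,
      one_mul, density, measure_congr hint]
    field_simp [(sqrt_abs_discr_pos K).ne']
  have hJ0 : volume (J \ interior U) = 0 := by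
    rw [measure_sdiff hα isOpen_interior.nullMeasurableSet hUtop, tsub_eq_zero_of_le hJle]
  have hU0 : volume (U \ interior U) = 0 := (ae_le_set.1 hint.symm.le)
  obtain ⟨τ, rfl⟩ := exists_smul_one_eq hn t
  have hτ : τ ≠ 0 := by
    rintro rfl
    simp at ht
  refine maxDiscrep_lt_one_of_ae_lt ?_
  filter_upwards [ae_forall_notMem_affine_image hJ0 (τ • (1 : mixedSpace K)),
    ae_forall_notMem_affine_image hU0 (τ • (1 : mixedSpace K))] with v hv1 hv2
  have hupper := card_lt_of_not_hasLargeDiscrepancy hU hc hl ht (v := v)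
    (S := (finite_setOf_mem_affine_image hU (τ • (1 : mixedSpace K)) v).toFinset) fun x hx => by
      obtain ⟨u, hu, hux⟩ := (Set.Finite.mem_toFinset _).1 hx
      refine ⟨u, by_contra fun h => hv2 x ⟨u, ⟨hu, h⟩, hux⟩, hux⟩
  rw [← Set.ncard_eq_toFinset_card _ (finite_setOf_mem_affine_image hU _ v)] at hupper
  change (Nat.card {x : 𝓞 K // mixedEmbedding K (x : K) ∈
    (fun u => τ • (1 : mixedSpace K) * u + v) '' U} : ℝ) < _ at hupper
  obtain ⟨β, rfl⟩ := exists_smul_one_eq hn v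
  obtain ⟨S, hS, hSm⟩ := exists_finset_int_lt_card α β (c := density K U) hτ
  have hlower := card_le_card_affine_image hU (t := τ • (1 : mixedSpace K))
    (v := β • (1 : mixedSpace K)) (S := S.image fun m : ℤ => (m : 𝓞 K)) fun x hx => by
      obtain ⟨m, hm, rfl⟩ := Finset.mem_image.1 hx
      have h1 : τ • (1 : mixedSpace K) * (((m : ℝ) - β) / τ) • (1 : mixedSpace K) +
          β • (1 : mixedSpace K) = mixedEmbedding K ((m : 𝓞 K) : K) := by
        rw [smul_mul_smul_comm, mul_div_cancel₀ _ hτ, one_mul, ← add_smul, sub_add_cancel]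
        rw [Int.cast_smul_eq_zsmul, zsmul_one]
        exact ((congrArg (mixedEmbedding K) (map_intCast (algebraMap (𝓞 K) K) m)).trans
          (map_intCast _ m)).symm
      exact ⟨_, interior_subset (by_contra fun h => hv1 m ⟨_, ⟨⟨_, hSm m hm, rfl⟩, h⟩, h1⟩), h1⟩
  rw [Finset.card_image_of_injective _ Int.cast_injective, ← Nat.cast_le (α := ℝ)] at hlower
  rw [norm_smul_one hn] at hupper
  unfold discrep
  change |_ - density K U * _| < 1
  rw [norm_smul_one hn, abs_lt]
  constructor <;> linarith

end

/-- Dichotomy for the maximal discrepancy: for a bounded measurable `U` whose boundary has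
Lebesgue measure zero, either `D_t(U) < 1` for every `t ∈ V^×`, or there exist `δ > 0` and
nonempty open sets `T ⊆ V^×` and `W ⊆ V` such that `D_t(U, v) > 1 + δ` for all `t ∈ T`,
`v ∈ W`. -/
theorem discrepancy_dichotomy (U : Set (mixedSpace K)) (hUb : Bornology.IsBounded U)
    (hUm : MeasurableSet U) (hUfr : volume (frontier U) = 0) :
    (∀ t : mixedSpace K, mixedEmbedding.norm t ≠ 0 → maxDiscrep K U t < 1) ∨
    (∃ δ : ℝ, 0 < δ ∧ ∃ T W : Set (mixedSpace K), IsOpen T ∧ T.Nonempty ∧ IsOpen W ∧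
      W.Nonempty ∧ (∀ t ∈ T, mixedEmbedding.norm t ≠ 0) ∧
      ∀ t ∈ T, ∀ v ∈ W, 1 + δ < discrep K U t v) := by
  by_cases hl : HasLargeDiscrepancy K U
  · exact Or.inr hl
  refine Or.inl fun t ht => ?_
  rcases (density_nonneg U).eq_or_lt with hc | hc
  · refine maxDiscrep_lt_one_of_volume_eq_zero ?_ t
    have h := (mul_eq_zero.1 hc.symm).resolve_left (inv_ne_zero (sqrt_abs_discr_pos K).ne')
    exact (ENNReal.toReal_eq_zero_iff _).1 h |>.resolve_right hUb.measure_lt_top.ne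
  · exact maxDiscrep_lt_one_of_finrank_eq_one hUb hUfr (le_antisymm
      (finrank_le_one_of_not_hasLargeDiscrepancy hUb hUfr hc hl) Module.finrank_pos) hc hl ht
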